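/- arXiv:1804.02697 — 4 statements merged into one kernel-verified Lean document; each statement's English description precedes it below -/
import Mathlib

section
/- Let T > 0, δ > 0 and ē ≥ 0. Let a : ℝ → ℝ be continuous with a(t) ≥ 0 for all t ≥ 0 and ∫_t^{t+T} a(τ) dτ ≥ δ for all t ≥ 0 (persistency of excitation). Let e : ℝ → ℝ satisfy |e(t)| ≤ ē for all t ≥ 0, and let x : ℝ → ℝ be differentiable on [0,∞) with x'(t) = −a(t)·x(t) + e(t) for all t ≥ 0. Then for all t ≥ 0, |x(t)| ≤ e^δ · e^{−(δ/T)·t} · |x(0)| + e^δ · (T/δ) · ē. In particular x converges exponentially into the residual ball of radius e^δ (T/δ) ē. -/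
open Filter Real

theorem nat_mul_le_integral_of_persistently_exciting {T δ : ℝ} (hT : 0 ≤ T) {a : ℝ → ℝ}
    (ha_cont : Continuous a) (ha_pe : ∀ t, 0 ≤ t → δ ≤ ∫ τ in t..(t + T), a τ)
    {s : ℝ} (hs : 0 ≤ s) (n : ℕ) : n * δ ≤ ∫ τ in s..(s + n * T), a τ := by
  induction n with
  | zero => simp
  | succ n ih =>
    have hstep := ha_pe (s + n * T) (by positivity)
    have hadd := intervalIntegral.integral_add_adjacent_intervals
      (ha_cont.intervalIntegrable (μ := MeasureTheory.volume) s (s + n * T))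
      (ha_cont.intervalIntegrable (s + n * T) (s + n * T + T))
    have hend : s + ((n + 1 : ℕ) : ℝ) * T = s + n * T + T := by push_cast; ring
    rw [hend, ← hadd]
    push_cast
    linarith

theorem le_integral_of_persistently_exciting {T δ : ℝ} (hT : 0 < T) (hδ : 0 ≤ δ) {a : ℝ → ℝ}
    (ha_cont : Continuous a) (ha_nonneg : ∀ t, 0 ≤ t → 0 ≤ a t)
    (ha_pe : ∀ t, 0 ≤ t → δ ≤ ∫ τ in t..(t + T), a τ)
    {s t : ℝ} (hs : 0 ≤ s) (hst : s ≤ t) : δ * ((t - s) / T - 1) ≤ ∫ τ in s..t, a τ := by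
  set n := ⌊(t - s) / T⌋₊
  have hfloor : (n : ℝ) * T ≤ t - s :=
    (le_div_iff₀ hT).1 (Nat.floor_le (div_nonneg (sub_nonneg.2 hst) hT.le))
  have hlt : (t - s) / T - 1 ≤ n := by
    linarith [Nat.lt_floor_add_one ((t - s) / T)]
  have hfull := nat_mul_le_integral_of_persistently_exciting hT.le ha_cont ha_pe hs n
  have hadd := intervalIntegral.integral_add_adjacent_intervals
    (ha_cont.intervalIntegrable (μ := MeasureTheory.volume) s (s + n * T))
    (ha_cont.intervalIntegrable (s + n * T) t)
  have hnT : 0 ≤ (n : ℝ) * T := by positivity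
  have hrest : 0 ≤ ∫ τ in (s + n * T)..t, a τ :=
    intervalIntegral.integral_nonneg (by linarith) fun u hu => ha_nonneg u (by linarith [hu.1])
  linarith [mul_le_mul_of_nonneg_left hlt hδ]

/-- Scalar perturbed gradient flow with persistently exciting nonnegative damping:
exponential convergence into a residual ball of radius `exp δ * (T/δ) * ē`. -/
theorem stmt_0 (T δ eb : ℝ) (hT : 0 < T) (hδ : 0 < δ) (heb : 0 ≤ eb)
    (a e x : ℝ → ℝ) (ha_cont : Continuous a)
    (ha_nonneg : ∀ t, 0 ≤ t → 0 ≤ a t)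
    (ha_pe : ∀ t, 0 ≤ t → δ ≤ ∫ τ in t..(t + T), a τ)
    (he : ∀ t, 0 ≤ t → |e t| ≤ eb)
    (hx : ∀ t, 0 ≤ t → HasDerivAt x (-(a t) * x t + e t) t) :
    ∀ t, 0 ≤ t →
      |x t| ≤ Real.exp δ * Real.exp (-(δ / T) * t) * |x 0|
        + Real.exp δ * (T / δ) * eb := by
  intro t ht
  set A : ℝ → ℝ := fun s => ∫ τ in (0 : ℝ)..s, a τ
  have hA_zero : A 0 = 0 := intervalIntegral.integral_same
  have hA_deriv : ∀ s, HasDerivAt A (a s) s := fun s =>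
    (ha_cont.integral_hasStrictDerivAt 0 s).hasDerivAt
  have hA_growth : ∀ s, 0 ≤ s → s ≤ t → δ * ((t - s) / T - 1) ≤ A t - A s := by
    intro s hs hst
    have hsub : A t - A s = ∫ τ in s..t, a τ :=
      intervalIntegral.integral_interval_sub_left
        (ha_cont.intervalIntegrable _ _) (ha_cont.intervalIntegrable _ _)
    rw [hsub]
    exact le_integral_of_persistently_exciting hT hδ.le ha_cont ha_nonneg ha_pe hs hst
  have hy : ∀ s, 0 ≤ s → HasDerivAt (fun r => exp (A r) * x r) (exp (A s) * e s) s := by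
    intro s hs
    exact ((hA_deriv s).exp.mul (hx s hs)).congr_deriv (by ring)
  -- A comparison function whose derivative dominates `eb * exp (A s)` on `[0, t]`.
  let c : ℝ := eb * exp (A t) * exp δ
  have hc : 0 ≤ c := by positivity
  let B : ℝ → ℝ := fun s => |x 0| + c * (T / δ) * exp (δ / T * (s - t))
  have hB : ∀ s, HasDerivAt B (c * exp (δ / T * (s - t))) s := by
    intro s
    refine (((((hasDerivAt_id s).sub_const t).const_mul (δ / T)).exp.const_mul
      (c * (T / δ))).const_add |x 0|).congr_deriv ?_
    simp only [id]
    field_simp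
  have hbound : ‖exp (A t) * x t‖ ≤ B t := by
    refine image_norm_le_of_norm_deriv_right_le_deriv_boundary (a := 0) (b := t)
      (f := fun r => exp (A r) * x r) (f' := fun s => exp (A s) * e s)
      (fun s hs => (hy s hs.1).continuousAt.continuousWithinAt)
      (fun s hs => (hy s hs.1).hasDerivWithinAt) ?_ hB ?_ ⟨ht, le_rfl⟩
    · simp only [hA_zero, exp_zero, one_mul, norm_eq_abs, B]
      have : 0 ≤ c * (T / δ) * exp (δ / T * (0 - t)) := by positivity
      linarith
    · intro s hs
      have hexp : exp (A s) ≤ exp (A t) * exp δ * exp (δ / T * (s - t)) := by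
        rw [← exp_add, ← exp_add, exp_le_exp]
        have hg := hA_growth s hs.1 hs.2.le
        have heq : δ * ((t - s) / T - 1) = -δ - δ / T * (s - t) := by ring
        linarith
      rw [norm_mul, norm_eq_abs, norm_eq_abs, abs_exp]
      calc exp (A s) * |e s|
          ≤ (exp (A t) * exp δ * exp (δ / T * (s - t))) * eb :=
            mul_le_mul hexp (he s hs.1) (abs_nonneg _) (by positivity)
        _ = c * exp (δ / T * (s - t)) := by simp only [c]; ring
  have hdecay : 1 ≤ exp (A t) * (exp δ * exp (-(δ / T) * t)) := by
    rw [← exp_add, ← exp_add, one_le_exp_iff]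
    have hg := hA_growth 0 le_rfl ht
    have heq : δ * ((t - 0) / T - 1) = -δ - -(δ / T) * t := by ring
    linarith
  refine le_of_mul_le_mul_left ?_ (exp_pos (A t))
  rw [norm_mul, norm_eq_abs, norm_eq_abs, abs_exp] at hbound
  have hBt : B t = |x 0| + exp (A t) * (exp δ * (T / δ) * eb) := by
    simp only [B, c, sub_self, mul_zero, exp_zero]
    ring
  have hinit := mul_le_mul_of_nonneg_right hdecay (abs_nonneg (x 0))
  linarith
end

section
/- Let A₀ > 0, ε > 0 and n a positive integer, and set S(t) := −(A₀/(2π))·cos(2πt/ε) and w := 2nε. Then for every t ∈ ℝ: (i) ∫₀^w S(t−μ) dμ = 0, and (ii) |∫₀^w μ·S(t−μ) dμ| ≤ w·A₀·ε/(4π²). -/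
open Real

/-- Antiderivative in the shift variable of the probing primitive. -/
lemma hasDerivAt_sin_shift (A₀ ε : ℝ) (hε : ε ≠ 0) (t x : ℝ) :
    HasDerivAt (fun μ => A₀ * ε / (4 * π ^ 2) * Real.sin (2 * π * (t - μ) / ε))
      (-(A₀ / (2 * π)) * Real.cos (2 * π * (t - x) / ε)) x := by
  have h : HasDerivAt (fun μ : ℝ => 2 * π * (t - μ) / ε) (2 * π * (-1) / ε) x :=
    (((hasDerivAt_id x).const_sub t).const_mul (2 * π)).div_const ε
  refine (h.sin.const_mul (A₀ * ε / (4 * π ^ 2))).congr_deriv ?_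
  have := Real.pi_ne_zero
  field_simp
  ring

/-- Antiderivative in the shift variable of the probing primitive times the shift. -/
lemma hasDerivAt_mul_sin_shift (A₀ ε : ℝ) (hε : ε ≠ 0) (t x : ℝ) :
    HasDerivAt (fun μ => μ * (A₀ * ε / (4 * π ^ 2) * Real.sin (2 * π * (t - μ) / ε)) -
        A₀ * ε ^ 2 / (8 * π ^ 3) * Real.cos (2 * π * (t - μ) / ε))
      (x * (-(A₀ / (2 * π)) * Real.cos (2 * π * (t - x) / ε))) x := by
  have h : HasDerivAt (fun μ : ℝ => 2 * π * (t - μ) / ε) (2 * π * (-1) / ε) x :=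
    (((hasDerivAt_id x).const_sub t).const_mul (2 * π)).div_const ε
  refine (((hasDerivAt_id x).mul (hasDerivAt_sin_shift A₀ ε hε t x)).sub
    (h.cos.const_mul (A₀ * ε ^ 2 / (8 * π ^ 3)))).congr_deriv ?_
  have := Real.pi_ne_zero
  simp only [id]
  field_simp
  ring

/-- Zeroth- and first-moment bounds for the probing primitive
`S(t) = -(A₀/(2π)) cos(2πt/ε)` over windows of `2n` full periods. -/
theorem stmt_3 (A₀ ε : ℝ) (hA : 0 < A₀) (hε : 0 < ε) (n : ℕ) (hn : 0 < n) :
    ∀ t : ℝ,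
      (∫ μ in (0 : ℝ)..(2 * n * ε),
          (-(A₀ / (2 * π)) * Real.cos (2 * π * (t - μ) / ε))) = 0 ∧
      |∫ μ in (0 : ℝ)..(2 * n * ε),
          μ * (-(A₀ / (2 * π)) * Real.cos (2 * π * (t - μ) / ε))|
        ≤ (2 * n * ε) * A₀ * ε / (4 * π ^ 2) := by
  intro t
  have hphase : 2 * π * (t - 2 * n * ε) / ε
      = 2 * π * (t - 0) / ε - ((2 * n : ℕ) : ℝ) * (2 * π) := by
    push_cast
    field_simp
    ring
  constructor
  · rw [intervalIntegral.integral_eq_sub_of_hasDerivAt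
      (fun x _ => hasDerivAt_sin_shift A₀ ε hε.ne' t x)
      (Continuous.intervalIntegrable (by fun_prop) _ _),
      hphase, Real.sin_sub_nat_mul_two_pi, sub_self]
  · rw [intervalIntegral.integral_eq_sub_of_hasDerivAt
      (fun x _ => hasDerivAt_mul_sin_shift A₀ ε hε.ne' t x)
      (Continuous.intervalIntegrable (by fun_prop) _ _),
      hphase, Real.sin_sub_nat_mul_two_pi, Real.cos_sub_nat_mul_two_pi]
    set s := Real.sin (2 * π * (t - 0) / ε)
    have hs1 : |s| ≤ 1 := Real.abs_sin_le_one _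
    have hK : 0 ≤ 2 * n * ε * A₀ * ε / (4 * π ^ 2) := by positivity
    calc _ = |2 * n * ε * A₀ * ε / (4 * π ^ 2) * s| := by congr 1; ring
      _ = 2 * n * ε * A₀ * ε / (4 * π ^ 2) * |s| := by rw [abs_mul, abs_of_nonneg hK]
      _ ≤ _ := mul_le_of_le_one_right hK hs1
end

section
/- Let A₀ > 0, γ > 0, n a positive integer, ē ≥ 0 and ε ∈ (0,1]. Set S(t) := −(A₀/(2π))·cos(2πt/ε) and d := nε. Let e : ℝ → ℝ satisfy |e(t)| ≤ ē for all t ≥ 0, and let θ̃ : ℝ → ℝ be differentiable on [0,∞) with θ̃'(t) = −γ·S(t−d)²·θ̃(t) + e(t) for all t ≥ 0. Then, with λ := γA₀²/(8π²) and K := e^{γA₀²/(8π²)}·(1 + 8π²/(γA₀²)), one has |θ̃(t)| ≤ K·e^{−λ t}·|θ̃(0)| + K·ē for all t ≥ 0; the constants K and λ do not depend on ε. -/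
open Real

/-- If `y' = -(l + p') y + f` on `[0, ∞)` with `|p| ≤ c` and `|f| ≤ b`, then `y` decays at
rate `l` into a ball of radius proportional to `b`. -/
theorem abs_le_of_hasDerivAt_of_bounded_primitive {l c b : ℝ} (hl : 0 < l) (hb : 0 ≤ b)
    {y f p p' : ℝ → ℝ} (hp : ∀ t, HasDerivAt p (p' t) t) (hpc : ∀ t, |p t| ≤ c)
    (hf : ∀ t, 0 ≤ t → |f t| ≤ b)
    (hy : ∀ t, 0 ≤ t → HasDerivAt y (-(l + p' t) * y t + f t) t) {t : ℝ} (ht : 0 ≤ t) :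
    |y t| ≤ exp (2 * c) * exp (-l * t) * |y 0| + exp (2 * c) / l * b := by
  have hder : ∀ s, 0 ≤ s → HasDerivAt (fun s => exp (l * s + p s) * y s)
      (exp (l * s + p s) * f s) s := fun s hs => by
    have h := ((((hasDerivAt_id s).const_mul l).add (hp s)).exp).mul (hy s hs)
    refine h.congr_deriv ?_
    simp only [Pi.add_apply, id]
    ring
  have hB : ∀ s, HasDerivAt (fun s => exp c * |y 0| + exp c * b / l * exp (l * s))
      (exp c * b * exp (l * s)) s := fun s => by
    have h := ((((hasDerivAt_id s).const_mul l).exp).const_mul (exp c * b / l)).const_add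
      (exp c * |y 0|)
    refine h.congr_deriv ?_
    simp only [id]
    field_simp
  have key : ‖exp (l * t + p t) * y t‖ ≤ exp c * |y 0| + exp c * b / l * exp (l * t) := by
    refine image_norm_le_of_norm_deriv_right_le_deriv_boundary
      (f := fun s => exp (l * s + p s) * y s) (a := 0) (b := t)
      (fun s hs => (hder s hs.1).continuousAt.continuousWithinAt)
      (fun s hs => (hder s hs.1).hasDerivWithinAt) ?_ hB (fun s hs => ?_) ⟨ht, le_rfl⟩
    · have h0 : exp (p 0) ≤ exp c := exp_le_exp.2 (abs_le.1 (hpc 0)).2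
      have h1 : exp (p 0) * |y 0| ≤ exp c * |y 0| := by gcongr
      have h2 : 0 ≤ exp c * b / l := by positivity
      simpa [abs_mul] using h1.trans (le_add_of_nonneg_right h2)
    · have h0 : exp (p s) ≤ exp c := exp_le_exp.2 (abs_le.1 (hpc s)).2
      rw [norm_mul, norm_eq_abs, norm_eq_abs, abs_exp, exp_add]
      calc exp (l * s) * exp (p s) * |f s| ≤ exp (l * s) * exp c * b := by
            gcongr
            exact hf s hs.1
        _ = exp c * b * exp (l * s) := by ring
  rw [norm_mul, norm_eq_abs, norm_eq_abs, abs_exp] at key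
  have hlow : exp (l * t - c) ≤ exp (l * t + p t) :=
    exp_le_exp.2 (by linarith [(abs_le.1 (hpc t)).1])
  have hkey := (mul_le_mul_of_nonneg_right hlow (abs_nonneg (y t))).trans key
  calc |y t| = exp (c - l * t) * (exp (l * t - c) * |y t|) := by
        rw [← mul_assoc, ← exp_add]; simp
    _ ≤ exp (c - l * t) * (exp c * |y 0| + exp c * b / l * exp (l * t)) := by gcongr
    _ = exp (2 * c) * exp (-l * t) * |y 0| + exp (2 * c) / l * b := by
        rw [show c - l * t = c + -l * t by ring, exp_add, two_mul, exp_add]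
        have h1 : exp (-l * t) * exp (l * t) = 1 := by rw [← exp_add]; simp
        linear_combination (exp c * exp c * b / l) * h1

/-- Error dynamics of the gradient virtual-output estimator: the damping
`γ S(t-d)²` is persistently exciting with ε-independent ratio, so the error
converges exponentially, at an ε-independent rate, into a residual ball
proportional to the perturbation size. -/
theorem stmt_8 (A₀ γ : ℝ) (hA : 0 < A₀) (hγ : 0 < γ) (n : ℕ) (hn : 0 < n)
    (eb ε : ℝ) (heb : 0 ≤ eb) (hε : ε ∈ Set.Ioc (0 : ℝ) 1)
    (e θt : ℝ → ℝ)
    (he : ∀ t, 0 ≤ t → |e t| ≤ eb)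
    (hθ : ∀ t, 0 ≤ t →
      HasDerivAt θt
        (-γ * (-(A₀ / (2 * π)) * Real.cos (2 * π * (t - n * ε) / ε)) ^ 2 * θt t
          + e t) t) :
    ∀ t, 0 ≤ t →
      |θt t| ≤
        (Real.exp (γ * A₀ ^ 2 / (8 * π ^ 2)) * (1 + 8 * π ^ 2 / (γ * A₀ ^ 2))) *
            Real.exp (-(γ * A₀ ^ 2 / (8 * π ^ 2)) * t) * |θt 0|
          + (Real.exp (γ * A₀ ^ 2 / (8 * π ^ 2)) * (1 + 8 * π ^ 2 / (γ * A₀ ^ 2))) *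
              eb := by
  intro t ht
  have hε0 : 0 < ε := hε.1
  have hpi := pi_gt_three
  set l := γ * A₀ ^ 2 / (8 * π ^ 2) with hl
  have hlpos : 0 < l := by positivity
  have hinv : 8 * π ^ 2 / (γ * A₀ ^ 2) = 1 / l := by rw [hl, one_div_div]
  have hp : ∀ s, HasDerivAt
      (fun s => l * ε / (4 * π) * sin (2 * (2 * π * (s - n * ε) / ε)))
      (l * cos (2 * (2 * π * (s - n * ε) / ε))) s := fun s => by
    have h := (((((((hasDerivAt_id s).sub_const (n * ε)).const_mul (2 * π)).div_const
      ε).const_mul 2).sin).const_mul (l * ε / (4 * π)))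
    refine h.congr_deriv ?_
    simp only [id]
    field_simp
    ring
  have hpc : ∀ s, |l * ε / (4 * π) * sin (2 * (2 * π * (s - n * ε) / ε))| ≤ l / 2 := fun s => by
    rw [abs_mul, abs_of_pos (by positivity : 0 < l * ε / (4 * π))]
    calc l * ε / (4 * π) * |sin (2 * (2 * π * (s - n * ε) / ε))|
        ≤ l * 1 / 2 * 1 := by
          gcongr
          · exact hε.2
          · linarith
          · exact abs_sin_le_one _
      _ = l / 2 := by ring
  have hmain := abs_le_of_hasDerivAt_of_bounded_primitive hlpos heb hp hpc he
    (fun s hs => (hθ s hs).congr_deriv (by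
      rw [cos_two_mul, hl]
      field_simp
      ring)) ht
  rw [mul_div_cancel₀ l two_ne_zero] at hmain
  rw [hinv]
  refine hmain.trans ?_
  have h1 : exp l ≤ exp l * (1 + 1 / l) :=
    le_mul_of_one_le_right (exp_pos l).le (le_add_of_nonneg_right (by positivity))
  have h2 : exp l / l ≤ exp l * (1 + 1 / l) := by
    rw [mul_add, mul_one, mul_one_div]
    exact le_add_of_nonneg_left (exp_pos l).le
  gcongr
end

section
/- Let a > 0, k ≠ 0 and R be real constants and let u, y : ℝ → ℝ be continuous. Suppose x₁, v₁, v₂, φ : ℝ → ℝ are differentiable on [0,∞) and satisfy, for all t ≥ 0: x₁'(t) = (R/k)·y(t) + u(t), v₁'(t) = −a·v₁(t) + a·u(t), v₂'(t) = −a·v₂(t) + a·x₁(t), and φ'(t) = −a·φ(t) + (a/k)·y(t). Define E(t) := −v₁(t) + a·x₁(t) − a·v₂(t) − R·φ(t). Then E'(t) = −a·E(t) for all t ≥ 0, and consequently E(t) = E(0)·e^{−a t}; i.e., the filtered signal Y_R* := −v₁ + a x₁ − a v₂ satisfies Y_R*(t) = R·φ(t) + ε_t with ε_t an exponentially decaying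 term. -/
open Real

/-- A solution of the scalar linear equation `f' = c f` on `[0, ∞)` is exponential. -/
theorem eq_mul_exp_of_hasDerivAt_mul_self {f : ℝ → ℝ} {c : ℝ}
    (hf : ∀ t, 0 ≤ t → HasDerivAt f (c * f t) t) {t : ℝ} (ht : 0 ≤ t) :
    f t = f 0 * Real.exp (c * t) := by
  have hg : ∀ s, 0 ≤ s → HasDerivAt (fun τ => f τ * Real.exp (-(c * τ))) 0 s := by
    intro s hs
    have he : HasDerivAt (fun τ => Real.exp (-(c * τ))) (Real.exp (-(c * s)) * -(c * 1)) s :=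
      ((hasDerivAt_id s).const_mul c).neg.exp
    exact ((hf s hs).mul he).congr_deriv (by ring)
  have hconst : f t * Real.exp (-(c * t)) = f 0 * Real.exp (-(c * 0)) :=
    constant_of_has_deriv_right_zero
      (fun s hs => (hg s hs.1).continuousAt.continuousWithinAt)
      (fun s hs => (hg s hs.1).hasDerivWithinAt) t ⟨ht, le_rfl⟩
  rw [mul_zero, neg_zero, Real.exp_zero, mul_one] at hconst
  rw [← hconst, mul_assoc, ← Real.exp_add, neg_add_cancel, Real.exp_zero, mul_one]

/-- Construction of the exact linear regression for the resistance: the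
discrepancy `E = -v₁ + a x₁ - a v₂ - R φ` of the filtered signals obeys
`E' = -aE`, hence decays exponentially: `Y_R* = R φ_R + ε_t`. -/
theorem stmt_9 (a k R : ℝ) (ha : 0 < a) (hk : k ≠ 0)
    (u y x₁ v₁ v₂ φ : ℝ → ℝ) (hu : Continuous u) (hy : Continuous y)
    (hx₁ : ∀ t, 0 ≤ t → HasDerivAt x₁ ((R / k) * y t + u t) t)
    (hv₁ : ∀ t, 0 ≤ t → HasDerivAt v₁ (-a * v₁ t + a * u t) t)
    (hv₂ : ∀ t, 0 ≤ t → HasDerivAt v₂ (-a * v₂ t + a * x₁ t) t)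
    (hφ : ∀ t, 0 ≤ t → HasDerivAt φ (-a * φ t + (a / k) * y t) t) :
    (∀ t, 0 ≤ t →
      HasDerivAt (fun τ => -v₁ τ + a * x₁ τ - a * v₂ τ - R * φ τ)
        (-a * (-v₁ t + a * x₁ t - a * v₂ t - R * φ t)) t) ∧
    (∀ t, 0 ≤ t →
      -v₁ t + a * x₁ t - a * v₂ t - R * φ t
        = (-v₁ 0 + a * x₁ 0 - a * v₂ 0 - R * φ 0) * Real.exp (-a * t)) := by
  have hE : ∀ t, 0 ≤ t →
      HasDerivAt (fun τ => -v₁ τ + a * x₁ τ - a * v₂ τ - R * φ τ)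
        (-a * (-v₁ t + a * x₁ t - a * v₂ t - R * φ t)) t := fun t ht =>
    ((((hv₁ t ht).neg.add ((hx₁ t ht).const_mul a)).sub ((hv₂ t ht).const_mul a)).sub
      ((hφ t ht).const_mul R)).congr_deriv (by ring)
  exact ⟨hE, fun t ht => eq_mul_exp_of_hasDerivAt_mul_self hE ht⟩
end
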